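/- arXiv:2203.00106 — 4 statements merged into one kernel-verified Lean document; each statement's English description precedes it below -/
import Mathlib

section
/- Let Y be a real Hilbert space, T a bounded linear operator from Y to Y that is bijective, and λ > 0 such that ⟪x, Tx⟫ + λ‖Tx‖² ≤ 0 for all x ∈ Y. Then for every maximally monotone multifunction M on Y, the composed multifunction M∘T has a unique fixed point; that is, there exists a unique e ∈ Y with (Te, e) ∈ G(M). -/
open scoped RealInnerProductSpace

/-- A multifunction on `Y`, identified with its graph `G ⊆ Y × Y`, is monotone. -/
def IsMonotoneGraph {Y : Type*} [NormedAddCommGroup Y] [InnerProductSpace ℝ Y]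
    (G : Set (Y × Y)) : Prop :=
  ∀ p ∈ G, ∀ q ∈ G, 0 ≤ ⟪p.1 - q.1, p.2 - q.2⟫

/-- A multifunction on `Y` is maximally monotone: it is monotone and its graph is not
properly contained in the graph of any other monotone multifunction. -/
def IsMaxMonotoneGraph {Y : Type*} [NormedAddCommGroup Y] [InnerProductSpace ℝ Y]
    (G : Set (Y × Y)) : Prop :=
  IsMonotoneGraph G ∧ ∀ G' : Set (Y × Y), IsMonotoneGraph G' → G ⊆ G' → G' = G

section

variable {Y : Type*} [NormedAddCommGroup Y] [InnerProductSpace ℝ Y]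

/-- A quadratic function whose second-order part is a nonnegative form is convex. -/
theorem convexOn_inner_sub_map_add (S : Y →L[ℝ] Y) (hS : ∀ u, 0 ≤ ⟪u, S u⟫) (y m : Y) :
    ConvexOn ℝ Set.univ fun u ↦ ⟪u - y, S u + m⟫ := by
  refine ⟨convex_univ, fun u _ v _ a b ha hb hab ↦ ?_⟩
  have h := mul_nonneg (mul_nonneg ha hb) (hS (u - v))
  obtain rfl : b = 1 - a := by linarith
  simp only [map_sub, map_add, map_smul, inner_sub_left, inner_sub_right, inner_add_left,
    inner_add_right, real_inner_smul_left, real_inner_smul_right, smul_eq_mul] at h ⊢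
  linarith

/-- The weighted average of monotone data, tested against its own barycenter. -/
theorem sum_mul_inner_barycenter_sub_nonpos {ι : Type*} [Fintype ι] (S : Y →L[ℝ] Y)
    (p : ι → Y × Y) (hp : ∀ i j, 0 ≤ ⟪(p i).1 - (p j).1, (p i).2 - (p j).2⟫)
    {b : ι → ℝ} (hb : b ∈ stdSimplex ℝ ι) :
    ∑ i, b i * ⟪(∑ j, b j • (p j).1) - (p i).1, S (∑ j, b j • (p j).1) + (p i).2⟫ ≤ 0 := by
  set u := ∑ j, b j • (p j).1 with hu
  have hsum : ∑ i, b i = 1 := hb.2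
  have hcenter : ∑ i, b i * ⟪u - (p i).1, S u⟫ = 0 := by
    simp_rw [← real_inner_smul_left, ← sum_inner, smul_sub, Finset.sum_sub_distrib,
      ← Finset.sum_smul, hsum]
    simp [hu]
  have hexpand : ∑ i, b i * ⟪u - (p i).1, (p i).2⟫ =
      ∑ i, ∑ j, b i * b j * ⟪(p j).1 - (p i).1, (p i).2⟫ := by
    refine Finset.sum_congr rfl fun i _ ↦ ?_
    have : u - (p i).1 = ∑ j, b j • ((p j).1 - (p i).1) := by
      simp_rw [smul_sub, Finset.sum_sub_distrib, ← Finset.sum_smul, hsum, one_smul, hu]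
    rw [this, sum_inner, Finset.mul_sum]
    exact Finset.sum_congr rfl fun j _ ↦ by rw [real_inner_smul_left, mul_assoc]
  have hswap := Finset.sum_comm (s := Finset.univ) (t := Finset.univ)
    (f := fun i j ↦ b i * b j * ⟪(p j).1 - (p i).1, (p i).2⟫)
  have hmono : ∑ i, ∑ j, b i * b j * ⟪(p j).1 - (p i).1, (p i).2⟫ +
      ∑ j, ∑ i, b i * b j * ⟪(p j).1 - (p i).1, (p i).2⟫ ≤ 0 := by
    rw [← Finset.sum_add_distrib]
    refine Finset.sum_nonpos fun i _ ↦ ?_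
    rw [← Finset.sum_add_distrib]
    refine Finset.sum_nonpos fun j _ ↦ ?_
    have h := mul_nonneg (mul_nonneg (hb.1 i) (hb.1 j)) (hp i j)
    simp only [inner_sub_left, inner_sub_right] at h ⊢
    linarith
  simp_rw [inner_add_right, mul_add, Finset.sum_add_distrib]
  linarith

/-- Finitely many of the inequalities characterizing a solution of `0 ∈ M u + S u` can be
solved simultaneously. -/
theorem exists_forall_inner_sub_map_add_nonpos {ι : Type*} [Fintype ι] [Nonempty ι]
    (S : Y →L[ℝ] Y) (hS : ∀ u, 0 ≤ ⟪u, S u⟫) (p : ι → Y × Y)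
    (hp : ∀ i j, 0 ≤ ⟪(p i).1 - (p j).1, (p i).2 - (p j).2⟫) :
    ∃ u : Y, ∀ i, ⟪u - (p i).1, S u + (p i).2⟫ ≤ 0 := by
  classical
  let L : (ι → ℝ) →ₗ[ℝ] Y := Fintype.linearCombination ℝ fun i ↦ (p i).1
  have hLapply (a : ι → ℝ) : L a = ∑ j, a j • (p j).1 := Fintype.linearCombination_apply ..
  have hL : Continuous L := L.continuous_of_finiteDimensional
  let f : (ι → ℝ) → (ι → ℝ) → ℝ := fun a b ↦ ∑ i, b i * ⟪L a - (p i).1, S (L a) + (p i).2⟫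
  have hne : (stdSimplex ℝ ι).Nonempty :=
    ⟨Pi.single (Classical.arbitrary ι) 1, single_mem_stdSimplex ℝ _⟩
  obtain ⟨a, -, b, hb, hab⟩ := Sion.exists_isSaddlePointOn (f := f) hne (convex_stdSimplex ℝ ι)
    (isCompact_stdSimplex ℝ ι)
    (fun b _ ↦ (Continuous.lowerSemicontinuous (by fun_prop)).lowerSemicontinuousOn _)
    (fun b hb ↦ by
      refine ConvexOn.quasiconvexOn ?_
      have hcvx : ConvexOn ℝ Set.univ fun a : ι → ℝ ↦ f a b := by
        refine ⟨convex_univ, fun x _ y _ s t hs ht hst ↦ ?_⟩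
        simp only [f, smul_eq_mul, Finset.mul_sum, ← Finset.sum_add_distrib]
        refine Finset.sum_le_sum fun i _ ↦ ?_
        have h := mul_le_mul_of_nonneg_left
          ((convexOn_inner_sub_map_add S hS (p i).1 (p i).2).2
            (Set.mem_univ (L x)) (Set.mem_univ (L y)) hs ht hst) (hb.1 i)
        simp only [map_add, map_smul, smul_eq_mul] at h ⊢
        linarith
      exact hcvx.subset (Set.subset_univ _) (convex_stdSimplex ℝ ι))
    (convex_stdSimplex ℝ ι) hne (isCompact_stdSimplex ℝ ι)
    (fun a _ ↦ (Continuous.upperSemicontinuous (by fun_prop)).upperSemicontinuousOn _)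
    (fun a _ ↦ by
      refine ConcaveOn.quasiconcaveOn ⟨convex_stdSimplex ℝ ι, fun x _ y _ s t _ _ _ ↦ ?_⟩
      simp only [f, smul_eq_mul, Finset.mul_sum, ← Finset.sum_add_distrib]
      refine (Finset.sum_congr rfl fun i _ ↦ ?_).le
      simp only [Pi.add_apply, Pi.smul_apply, smul_eq_mul]
      ring)
  refine ⟨L a, fun i ↦ ?_⟩
  have hdiag : f b b ≤ 0 := by
    simpa only [f, hLapply] using sum_mul_inner_barycenter_sub_nonpos S p hp hb
  have hsingle : f a (Pi.single i 1) = ⟪L a - (p i).1, S (L a) + (p i).2⟫ := by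
    simp [f, Pi.single_apply]
  exact hsingle ▸ (hab b hb _ (single_mem_stdSimplex ℝ i)).trans hdiag

/-- A pair monotonically related to a maximally monotone graph belongs to it. -/
theorem IsMaxMonotoneGraph.mem_of_forall {M : Set (Y × Y)} (hM : IsMaxMonotoneGraph M) {q : Y × Y}
    (hq : ∀ p ∈ M, 0 ≤ ⟪q.1 - p.1, q.2 - p.2⟫) : q ∈ M := by
  rw [← hM.2 (insert q M) ?_ (Set.subset_insert q M)]
  · exact Set.mem_insert q M
  · rintro p (rfl | hp) r (rfl | hr)
    · simp
    · exact hq r hr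
    · rw [← neg_sub, ← neg_sub r.2, inner_neg_neg]
      exact hq p hp
    · exact hM.1 p hp r hr

theorem IsMaxMonotoneGraph.nonempty {M : Set (Y × Y)} (hM : IsMaxMonotoneGraph M) :
    M.Nonempty := by
  by_contra! h
  exact (Set.eq_empty_iff_forall_notMem.1 h 0) (hM.mem_of_forall (by simp [h]))

/-- The sublevel set of a convex quadratic is weak-* closed, because the quadratic is the
supremum of its affine tangents. -/
theorem isClosed_setOf_inner_sub_map_add_nonpos [CompleteSpace Y] (S : Y →L[ℝ] Y)
    (hS : ∀ u, 0 ≤ ⟪u, S u⟫) (y m : Y) :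
    IsClosed {φ : WeakDual ℝ Y |
      ⟪(InnerProductSpace.toDual ℝ Y).symm (WeakDual.toStrongDual φ) - y,
        S ((InnerProductSpace.toDual ℝ Y).symm (WeakDual.toStrongDual φ)) + m⟫ ≤ 0} := by
  have htangent : {φ : WeakDual ℝ Y |
      ⟪(InnerProductSpace.toDual ℝ Y).symm (WeakDual.toStrongDual φ) - y,
        S ((InnerProductSpace.toDual ℝ Y).symm (WeakDual.toStrongDual φ)) + m⟫ ≤ 0} =
      ⋂ v : Y, {φ : WeakDual ℝ Y | φ (S.adjoint v) + φ (S v) - ⟪v, S v⟫ + φ m -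
        φ (S.adjoint y) - ⟪y, m⟫ ≤ 0} := by
    ext φ
    simp only [Set.mem_ofPred_eq, Set.mem_iInter]
    set u := (InnerProductSpace.toDual ℝ Y).symm (WeakDual.toStrongDual φ) with hu
    have hφ (w : Y) : φ w = ⟪u, w⟫ := by
      rw [hu, InnerProductSpace.toDual_symm_apply]
      rfl
    have hadj (w : Y) : φ (S.adjoint w) = ⟪w, S u⟫ := by
      rw [hφ, ContinuousLinearMap.adjoint_inner_right, real_inner_comm]
    simp only [hadj, hφ]
    constructor
    · intro h v
      have hpos := hS (u - v)
      simp only [map_sub, inner_sub_left, inner_sub_right, inner_add_right] at h hpos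
      linarith
    · intro h
      have hself := h u
      simp only [inner_sub_left, inner_add_right]
      linarith
  rw [htangent]
  refine isClosed_iInter fun v ↦ isClosed_le ?_ continuous_const
  have heval (w : Y) : Continuous fun φ : WeakDual ℝ Y ↦ φ w := WeakDual.eval_continuous w
  exact ((((((heval _).add (heval _)).sub continuous_const).add (heval _)).sub
    (heval _)).sub continuous_const)

/-- If `S` is bounded and strongly monotone and `M` is maximally monotone, then
`0 ∈ M u + S u` has a solution. -/
theorem IsMaxMonotoneGraph.exists_neg_map_mem [CompleteSpace Y] {M : Set (Y × Y)}
    (hM : IsMaxMonotoneGraph M) (S : Y →L[ℝ] Y) {c : ℝ} (hc : 0 < c)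
    (hS : ∀ u, c * ‖u‖ ^ 2 ≤ ⟪u, S u⟫) : ∃ u : Y, (u, -S u) ∈ M := by
  classical
  have hS0 (u : Y) : 0 ≤ ⟪u, S u⟫ := (by positivity : 0 ≤ c * ‖u‖ ^ 2).trans (hS u)
  obtain ⟨p₀, hp₀⟩ := hM.nonempty
  let J := InnerProductSpace.toDual ℝ Y
  let C : M → Set (WeakDual ℝ Y) := fun p ↦ {φ | ⟪J.symm (WeakDual.toStrongDual φ) - p.1.1,
    S (J.symm (WeakDual.toStrongDual φ)) + p.1.2⟫ ≤ 0}
  have hbound (u : Y) (hu : ⟪u - p₀.1, S u + p₀.2⟫ ≤ 0) : ‖u - p₀.1‖ ≤ ‖S p₀.1 + p₀.2‖ / c := by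
    have hcoer := hS (u - p₀.1)
    have hcs := neg_le_of_abs_le (abs_real_inner_le_norm (u - p₀.1) (S p₀.1 + p₀.2))
    have hsplit : S u + p₀.2 = S (u - p₀.1) + (S p₀.1 + p₀.2) := by rw [map_sub]; abel
    rw [hsplit, inner_add_right] at hu
    rw [le_div_iff₀ hc]
    by_contra! hlt
    have hpos : 0 < ‖u - p₀.1‖ := by
      refine (norm_nonneg _).lt_of_ne fun h ↦ ?_
      rw [← h, zero_mul] at hlt
      exact (norm_nonneg _).not_gt hlt
    nlinarith [mul_lt_mul_of_pos_left hlt hpos]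
  obtain ⟨φ, -, hφ⟩ := (WeakDual.isCompact_closedBall (𝕜 := ℝ) (J p₀.1)
      (‖S p₀.1 + p₀.2‖ / c)).inter_iInter_nonempty C
    (fun p ↦ isClosed_setOf_inner_sub_map_add_nonpos S hS0 p.1.1 p.1.2) fun F ↦ by
      let F' : Finset M := insert ⟨p₀, hp₀⟩ F
      have : Nonempty F' := ⟨⟨⟨p₀, hp₀⟩, Finset.mem_insert_self _ _⟩⟩
      obtain ⟨u, hu⟩ := exists_forall_inner_sub_map_add_nonpos S hS0
        (fun i : F' ↦ (i.1.1 : Y × Y)) fun i j ↦ hM.1 _ i.1.2 _ j.1.2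
      refine ⟨StrongDual.toWeakDual (J u), ?_, Set.mem_iInter₂.2 fun p hp ↦ ?_⟩
      · have h := hbound u (hu ⟨⟨p₀, hp₀⟩, Finset.mem_insert_self _ _⟩)
        simpa [dist_eq_norm, ← map_sub] using h
      · simpa [C] using hu ⟨p, Finset.mem_insert_of_mem hp⟩
  refine ⟨J.symm (WeakDual.toStrongDual φ), hM.mem_of_forall fun p hp ↦ ?_⟩
  have h : ⟪J.symm (WeakDual.toStrongDual φ) - p.1,
      S (J.symm (WeakDual.toStrongDual φ)) + p.2⟫ ≤ 0 := Set.mem_iInter.1 hφ ⟨p, hp⟩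
  rw [← neg_add', inner_neg_right]
  linarith

end

theorem stmt_6 {Y : Type*} [NormedAddCommGroup Y] [InnerProductSpace ℝ Y] [CompleteSpace Y]
    (T : Y →L[ℝ] Y) (hT : Function.Bijective T) (lam : ℝ) (hlam : 0 < lam)
    (hTq : ∀ x : Y, ⟪x, T x⟫ + lam * ‖T x‖ ^ 2 ≤ 0)
    (M : Set (Y × Y)) (hM : IsMaxMonotoneGraph M) :
    ∃! e : Y, (T e, e) ∈ M := by
  let E : Y ≃L[ℝ] Y := ContinuousLinearEquiv.ofBijective T
    (LinearMap.ker_eq_bot.2 hT.1) (LinearMap.range_eq_top.2 hT.2)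
  have hE (u : Y) : T (E.symm u) = u := E.apply_symm_apply u
  obtain ⟨u, hu⟩ := hM.exists_neg_map_mem (-(E.symm : Y →L[ℝ] Y)) hlam fun u ↦ by
    have h := hTq (E.symm u)
    rw [hE, real_inner_comm] at h
    simp only [neg_apply, inner_neg_right, ContinuousLinearEquiv.coe_coe]
    linarith
  refine ⟨E.symm u, ?_, fun e he ↦ ?_⟩
  · simpa [hE] using hu
  · have hmem : (T (E.symm u), E.symm u) ∈ M := by simpa [hE] using hu
    have hmono := hM.1 _ he _ hmem
    have hneg := hTq (e - E.symm u)
    simp only at hmono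
    rw [← map_sub, real_inner_comm] at hmono
    have hzero : ‖T (e - E.symm u)‖ ^ 2 ≤ 0 := by
      by_contra! h
      linarith [mul_pos hlam h]
    have hker : T (e - E.symm u) = 0 := by
      simpa using le_antisymm hzero (sq_nonneg _)
    rw [map_sub, sub_eq_zero] at hker
    exact hT.1 hker
end

section
/- Let X be a real Hilbert space and Y a closed subspace of X. Let S be a bounded linear operator from X to Y whose restriction S|_Y : Y → Y is bijective, and suppose ⟪x, Sx⟫ + ½‖Sx‖² = 0 for all x ∈ X. Let f : X → (−∞, ∞] be proper, convex and lower semicontinuous, and suppose that the restriction f*|_Y of the Fenchel conjugate f* to Y is proper (hence belongs to Γ₀(Y)). Then the multifunction ∂(f*|_Y) ∘ S|_Y on Y has a unique fixed point; that is, there exists a unique e ∈ Y with e ∈ ∂(f*|_Y)(Se). -/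
open scoped RealInnerProductSpace

noncomputable section

/-- `f` is a proper function into `(-∞, ∞]`: it never takes the value `⊥` and is
somewhere finite. -/
def IsProperFn {H : Type*} (f : H → EReal) : Prop :=
  (∀ x, f x ≠ ⊥) ∧ ∃ x, f x ≠ ⊤

/-- `f` is a convex extended-real-valued function. -/
def IsConvexFn {H : Type*} [AddCommGroup H] [Module ℝ H] (f : H → EReal) : Prop :=
  ∀ x y : H, ∀ a b : ℝ, 0 ≤ a → 0 ≤ b → a + b = 1 →
    f (a • x + b • y) ≤ (a : EReal) * f x + (b : EReal) * f y

/-- The Fenchel conjugate of `f`. -/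
def fenchel {H : Type*} [NormedAddCommGroup H] [InnerProductSpace ℝ H] (f : H → EReal) :
    H → EReal := fun p => ⨆ x : H, ((⟪x, p⟫ : ℝ) : EReal) - f x

/-- The subdifferential of `g` at `y`. -/
def subdiff {H : Type*} [NormedAddCommGroup H] [InnerProductSpace ℝ H] (g : H → EReal)
    (y : H) : Set H := {p | ∀ z : H, g y + ((⟪z - y, p⟫ : ℝ) : EReal) ≤ g z}

section ProximalPoint

variable {H : Type*} [NormedAddCommGroup H] [InnerProductSpace ℝ H]

/-- A linear function perturbed by a positive quadratic is bounded below. -/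
theorem inner_add_sq_norm_sub_bounded_below (a v z : H) {c : ℝ} (hc : 0 < c) :
    ⟪a, v⟫ - ‖a‖ ^ 2 / (2 * c) ≤ ⟪a, z⟫ + c / 2 * ‖z - v‖ ^ 2 := by
  have h₁ : ⟪a, z⟫ = ⟪a, v⟫ + ⟪a, z - v⟫ := by rw [inner_sub_right]; ring
  have h₂ : -(‖a‖ * ‖z - v‖) ≤ ⟪a, z - v⟫ :=
    (abs_le.1 (abs_real_inner_le_norm a (z - v))).1
  have h₃ : c / 2 * ‖z - v‖ ^ 2 - ‖a‖ * ‖z - v‖ + ‖a‖ ^ 2 / (2 * c)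
      = (c * ‖z - v‖ - ‖a‖) ^ 2 / (2 * c) := by field_simp; ring
  have h₄ : 0 ≤ (c * ‖z - v‖ - ‖a‖) ^ 2 / (2 * c) := by positivity
  linarith

theorem sq_norm_midpoint_sub (x y v : H) :
    ‖(1 / 2 : ℝ) • x + (1 / 2 : ℝ) • y - v‖ ^ 2
      = (‖x - v‖ ^ 2 + ‖y - v‖ ^ 2) / 2 - ‖x - y‖ ^ 2 / 4 := by
  have h₁ : (1 / 2 : ℝ) • x + (1 / 2 : ℝ) • y - v
      = (1 / 2 : ℝ) • ((x - v) + (y - v)) := by module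
  have h₂ : x - y = (x - v) - (y - v) := by abel
  have h₃ := parallelogram_law_with_norm ℝ (x - v) (y - v)
  rw [h₁, norm_smul, mul_pow]
  rw [← h₂] at h₃
  rw [show ‖(1 / 2 : ℝ)‖ ^ 2 = 1 / 4 by norm_num]
  linarith

/-- A closed convex epigraph minorized by an affine function carries a minimizer of
`(z, r) ↦ r + c / 2 * ‖z - v‖ ^ 2`. -/
theorem exists_epigraph_quadratic_minimizer [CompleteSpace H] {E : Set (H × ℝ)}
    (hE : IsClosed E) (hconv : Convex ℝ E) (hne : E.Nonempty)
    {a : H} {b : ℝ} (hab : ∀ q ∈ E, ⟪a, q.1⟫ - b ≤ q.2) {c : ℝ} (hc : 0 < c) (v : H) :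
    ∃ p ∈ E, ∀ q ∈ E, p.2 + c / 2 * ‖p.1 - v‖ ^ 2 ≤ q.2 + c / 2 * ‖q.1 - v‖ ^ 2 := by
  set J : H × ℝ → ℝ := fun q => q.2 + c / 2 * ‖q.1 - v‖ ^ 2 with hJ
  have hbdd : BddBelow (J '' E) := by
    refine ⟨⟪a, v⟫ - ‖a‖ ^ 2 / (2 * c) - b, ?_⟩
    rintro _ ⟨q, hq, rfl⟩
    have := inner_add_sq_norm_sub_bounded_below a v q.1 hc
    have := hab q hq
    simp only [hJ]
    linarith
  set m := sInf (J '' E) with hm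
  have hmle : ∀ q ∈ E, m ≤ J q := fun q hq => csInf_le hbdd ⟨q, hq, rfl⟩
  have hseq : ∀ n : ℕ, ∃ q ∈ E, J q < m + 1 / ((n : ℝ) + 1) := by
    intro n
    obtain ⟨_, ⟨q, hq, rfl⟩, hlt⟩ := exists_lt_of_csInf_lt (hne.image J)
      (lt_add_of_pos_right m (Nat.one_div_pos_of_nat (n := n)))
    exact ⟨q, hq, hlt⟩
  choose u huE hu using hseq
  have hgap : ∀ q ∈ E, ∀ q' ∈ E, c / 8 * ‖q.1 - q'.1‖ ^ 2 ≤ (J q + J q') / 2 - m := by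
    intro q hq q' hq'
    have h := hmle _ (hconv hq hq' (by norm_num : (0 : ℝ) ≤ 1 / 2)
      (by norm_num : (0 : ℝ) ≤ 1 / 2) (by norm_num))
    have hmid := sq_norm_midpoint_sub q.1 q'.1 v
    simp only [hJ, Prod.fst_add, Prod.smul_fst, Prod.snd_add, Prod.smul_snd, smul_eq_mul] at h ⊢
    rw [hmid] at h
    linarith
  have hone : Filter.Tendsto (fun n : ℕ => 1 / ((n : ℝ) + 1)) Filter.atTop (nhds 0) :=
    tendsto_one_div_add_atTop_nhds_zero_nat
  have hcauchy : CauchySeq (fun n => (u n).1) := by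
    refine cauchySeq_of_le_tendsto_0 (fun n : ℕ => √(8 / c * (1 / ((n : ℝ) + 1)))) ?_ ?_
    · intro n k N hn hk
      rw [dist_eq_norm]
      refine Real.le_sqrt_of_sq_le ?_
      have h₁ := hgap _ (huE n) _ (huE k)
      have h₂ := Nat.one_div_le_one_div (α := ℝ) hn
      have h₃ := Nat.one_div_le_one_div (α := ℝ) hk
      have h₄ := hu n
      have h₅ := hu k
      rw [div_mul_eq_mul_div, le_div_iff₀ hc]
      linarith
    · simpa using (hone.const_mul (8 / c)).sqrt
  obtain ⟨p, hp⟩ := cauchySeq_tendsto_of_complete hcauchy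
  have hJu : Filter.Tendsto (fun n => J (u n)) Filter.atTop (nhds m) := by
    refine tendsto_of_tendsto_of_tendsto_of_le_of_le tendsto_const_nhds
      (by simpa using hone.const_add m) (fun n => hmle _ (huE n)) (fun n => (hu n).le)
  have hs : Filter.Tendsto (fun n => (u n).2) Filter.atTop
      (nhds (m - c / 2 * ‖p - v‖ ^ 2)) := by
    have h := hJu.sub ((((hp.sub_const v).norm).pow 2).const_mul (c / 2))
    refine h.congr fun n => ?_
    simp [hJ]
  refine ⟨(p, m - c / 2 * ‖p - v‖ ^ 2),
    hE.mem_of_tendsto (hp.prodMk_nhds hs) (Filter.Eventually.of_forall huE), fun q hq => ?_⟩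
  have := hmle q hq
  simp only [hJ] at this ⊢
  linarith

/-- Existence of proximal points, in terms of the epigraph. -/
theorem exists_epigraph_proximal_point [CompleteSpace H] {E : Set (H × ℝ)}
    (hE : IsClosed E) (hconv : Convex ℝ E) (hne : E.Nonempty)
    {a : H} {b : ℝ} (hab : ∀ q ∈ E, ⟪a, q.1⟫ - b ≤ q.2) {c : ℝ} (hc : 0 < c) (v : H) :
    ∃ p ∈ E, ∀ q ∈ E, p.2 + c * ⟪v - p.1, q.1 - p.1⟫ ≤ q.2 := by
  obtain ⟨p, hp, hmin⟩ := exists_epigraph_quadratic_minimizer hE hconv hne hab hc v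
  refine ⟨p, hp, fun q hq => ?_⟩
  have hstep : ∀ t : ℝ, 0 < t → t ≤ 1 →
      p.2 + c * ⟪v - p.1, q.1 - p.1⟫ ≤ q.2 + t * (c / 2 * ‖q.1 - p.1‖ ^ 2) := by
    intro t ht ht₁
    have h := hmin _ (hconv hp hq (sub_nonneg.2 ht₁) ht.le (by ring))
    have hvec : (1 - t) • p.1 + t • q.1 - v = (p.1 - v) + t • (q.1 - p.1) := by module
    simp only [Prod.fst_add, Prod.smul_fst, Prod.snd_add, Prod.smul_snd, smul_eq_mul] at h
    rw [hvec, norm_add_sq_real, real_inner_smul_right, norm_smul, mul_pow, Real.norm_eq_abs,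
      sq_abs] at h
    have hneg : ⟪v - p.1, q.1 - p.1⟫ = -⟪p.1 - v, q.1 - p.1⟫ := by
      rw [← inner_neg_left, neg_sub]
    rw [hneg]
    refine le_of_mul_le_mul_left ?_ ht
    linarith
  have hlim : Filter.Tendsto (fun t : ℝ => q.2 + t * (c / 2 * ‖q.1 - p.1‖ ^ 2))
      (nhdsWithin 0 (Set.Ioi 0)) (nhds q.2) := by
    refine Filter.Tendsto.mono_left ?_ nhdsWithin_le_nhds
    have : Continuous fun t : ℝ => q.2 + t * (c / 2 * ‖q.1 - p.1‖ ^ 2) := by fun_prop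
    simpa using this.tendsto 0
  refine ge_of_tendsto hlim ?_
  filter_upwards [Ioc_mem_nhdsGT (zero_lt_one (α := ℝ))] with t ht
  exact hstep t ht.1 ht.2

/-- Proximal points depend on the base point in a nonexpansive way. -/
theorem norm_sub_le_of_epigraph_proximal {E : Set (H × ℝ)} {c : ℝ} (hc : 0 < c) {v v' : H}
    {p p' : H × ℝ} (hp : p ∈ E) (hp' : p' ∈ E)
    (h : ∀ q ∈ E, p.2 + c * ⟪v - p.1, q.1 - p.1⟫ ≤ q.2)
    (h' : ∀ q ∈ E, p'.2 + c * ⟪v' - p'.1, q.1 - p'.1⟫ ≤ q.2) :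
    ‖p.1 - p'.1‖ ≤ ‖v - v'‖ := by
  have h₁ := h p' hp'
  have h₂ := h' p hp
  have hid : ⟪v - p.1, p'.1 - p.1⟫ + ⟪v' - p'.1, p.1 - p'.1⟫
      = ‖p.1 - p'.1‖ ^ 2 - ⟪v - v', p.1 - p'.1⟫ := by
    rw [← real_inner_self_eq_norm_sq]
    simp only [inner_sub_left, inner_sub_right]
    ring
  have h₃ : c * (‖p.1 - p'.1‖ ^ 2 - ⟪v - v', p.1 - p'.1⟫) ≤ 0 := by
    rw [← hid]; linarith
  have h₄ : ‖p.1 - p'.1‖ ^ 2 - ⟪v - v', p.1 - p'.1⟫ ≤ 0 := by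
    by_contra! hpos
    exact absurd (mul_pos hc hpos) (not_lt.2 h₃)
  have h₅ := real_inner_le_norm (v - v') (p.1 - p'.1)
  by_contra! hlt
  nlinarith [norm_nonneg (v - v')]

/-- Solvability of a variational inequality of the second kind for a bounded coercive operator,
in terms of the epigraph. -/
theorem exists_epigraph_variational_inequality [CompleteSpace H] {E : Set (H × ℝ)}
    (hE : IsClosed E) (hconv : Convex ℝ E) (hne : E.Nonempty)
    {a : H} {b : ℝ} (hab : ∀ q ∈ E, ⟪a, q.1⟫ - b ≤ q.2) (A : H →L[ℝ] H)
    (hA : ∀ w, (1 / 2) * ‖w‖ ^ 2 ≤ ⟪A w, w⟫) :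
    ∃ p ∈ E, ∀ q ∈ E, p.2 - ⟪A p.1, q.1 - p.1⟫ ≤ q.2 := by
  set c : ℝ := 2 * ‖A‖ ^ 2 + 1 with hcdef
  have hc : 0 < c := by positivity
  have hc₁ : 1 ≤ c := by nlinarith [sq_nonneg ‖A‖]
  choose P hPE hP using exists_epigraph_proximal_point hE hconv hne hab hc
  set K : ℝ := √(1 - 1 / (2 * c)) with hK
  have hinv : 1 / (2 * c) ≤ 1 / 2 := by
    apply one_div_le_one_div_of_le <;> linarith
  have hinv₀ : 0 < 1 / (2 * c) := by positivity
  have hstep : ∀ d : H, ‖d - c⁻¹ • A d‖ ≤ K * ‖d‖ := by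
    intro d
    have hAd : ‖A d‖ ^ 2 ≤ ‖A‖ ^ 2 * ‖d‖ ^ 2 := by
      rw [← mul_pow]; gcongr; exact A.le_opNorm d
    have hsq : ‖d - c⁻¹ • A d‖ ^ 2 ≤ (1 - 1 / (2 * c)) * ‖d‖ ^ 2 := by
      rw [norm_sub_sq_real, real_inner_smul_right, norm_smul, mul_pow, real_inner_comm,
        Real.norm_eq_abs, sq_abs]
      have e₁ : c⁻¹ * ((1 / 2) * ‖d‖ ^ 2) ≤ c⁻¹ * ⟪A d, d⟫ := by gcongr; exact hA d
      have e₂ : c⁻¹ ^ 2 * ‖A d‖ ^ 2 ≤ c⁻¹ ^ 2 * (c / 2 * ‖d‖ ^ 2) := by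
        gcongr
        nlinarith [sq_nonneg ‖d‖]
      have e₃ : c⁻¹ ^ 2 * (c / 2 * ‖d‖ ^ 2) = c⁻¹ / 2 * ‖d‖ ^ 2 := by field_simp
      have e₄ : 1 / (2 * c) = c⁻¹ / 2 := by field_simp
      rw [e₄]
      linarith
    refine abs_le_of_sq_le_sq' ?_ (by positivity) |>.2
    rw [mul_pow, hK, Real.sq_sqrt (by linarith)]
    exact hsq
  have hcontr : ContractingWith K.toNNReal
      (fun w : H => (P (w - c⁻¹ • A w)).1) := by
    refine ⟨?_, LipschitzWith.of_dist_le_mul fun w w' => ?_⟩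
    · rw [Real.toNNReal_lt_one, hK, Real.sqrt_lt' one_pos]
      linarith
    · rw [dist_eq_norm, dist_eq_norm, Real.coe_toNNReal K (Real.sqrt_nonneg _)]
      refine (norm_sub_le_of_epigraph_proximal hc (hPE _) (hPE _) (hP _) (hP _)).trans ?_
      have hlin : (w - c⁻¹ • A w) - (w' - c⁻¹ • A w') = (w - w') - c⁻¹ • A (w - w') := by
        rw [map_sub]; module
      rw [hlin]
      exact hstep _
  set w := ContractingWith.fixedPoint _ hcontr
  have hfix : (P (w - c⁻¹ • A w)).1 = w := hcontr.fixedPoint_isFixedPt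
  refine ⟨P (w - c⁻¹ • A w), hPE _, fun q hq => ?_⟩
  have h := hP (w - c⁻¹ • A w) q hq
  rw [hfix] at h ⊢
  have hvec : w - c⁻¹ • A w - w = -(c⁻¹ • A w) := by abel
  rw [hvec, inner_neg_left, real_inner_smul_left, mul_neg, mul_inv_cancel_left₀ hc.ne'] at h
  linarith

end ProximalPoint

/-- For `f` nowhere `⊥`, the epigraph of its conjugate is an intersection of half-spaces. -/
theorem fenchel_le_coe_iff {H : Type*} [NormedAddCommGroup H] [InnerProductSpace ℝ H]
    {f : H → EReal} (hf : ∀ x, f x ≠ ⊥) (p : H) (r : ℝ) :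
    fenchel f p ≤ (r : EReal) ↔ ∀ x, f x ≠ ⊤ → ⟪x, p⟫ - (f x).toReal ≤ r := by
  unfold fenchel
  rw [iSup_le_iff]
  refine forall_congr' fun x => ?_
  by_cases hx : f x = ⊤
  · simp [hx]
  · rw [← EReal.coe_toReal hx (hf x), ← EReal.coe_sub, EReal.coe_le_coe_iff]
    simp

/-- The subdifferential of a proper function is monotone. -/
theorem inner_sub_nonneg_of_mem_subdiff {H : Type*} [NormedAddCommGroup H]
    [InnerProductSpace ℝ H] {g : H → EReal} (hg : IsProperFn g) {y y' p p' : H}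
    (hp : p ∈ subdiff g y) (hp' : p' ∈ subdiff g y') : 0 ≤ ⟪y - y', p - p'⟫ := by
  obtain ⟨hbot, z, hz⟩ := hg
  have hfin : ∀ {x q : H}, q ∈ subdiff g x → g x ≠ ⊤ := by
    intro x q hq hx
    have h := hq z
    rw [hx, EReal.top_add_coe, top_le_iff] at h
    exact hz h
  have h := hp y'
  have h' := hp' y
  rw [← EReal.coe_toReal (hfin hp) (hbot y), ← EReal.coe_toReal (hfin hp') (hbot y'),
    ← EReal.coe_add, EReal.coe_le_coe_iff] at h h'
  have hid : ⟪y - y', p - p'⟫ = -(⟪y' - y, p⟫ + ⟪y - y', p'⟫) := by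
    simp only [inner_sub_left, inner_sub_right]; ring
  rw [hid]
  linarith

theorem stmt_8 {X : Type*} [NormedAddCommGroup X] [InnerProductSpace ℝ X] [CompleteSpace X]
    (Y : Submodule ℝ X) (hY : IsClosed (Y : Set X))
    (S : X →L[ℝ] Y)
    (hbij : Function.Bijective (fun y : Y => S (y : X)))
    (hS : ∀ x : X, ⟪x, ((S x : Y) : X)⟫ + (1 / 2) * ‖S x‖ ^ 2 = 0)
    (f : X → EReal) (hf : IsProperFn f) (hconv : IsConvexFn f)
    (hlsc : LowerSemicontinuous f)
    (hres : IsProperFn (fun y : Y => fenchel f (y : X))) :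
    ∃! e : Y, e ∈ subdiff (fun y : Y => fenchel f (y : X)) (S (e : X)) := by
  have : CompleteSpace Y := hY.completeSpace_coe
  have hSY : ∀ y : Y, ⟪y, S (y : X)⟫ + (1 / 2) * ‖S (y : X)‖ ^ 2 = 0 := fun y => hS y
  refine existsUnique_of_exists_of_unique ?_ ?_
  · let T : Y ≃L[ℝ] Y := ContinuousLinearEquiv.ofBijective (S ∘L Y.subtypeL)
      (LinearMap.ker_eq_bot.2 hbij.1) (LinearMap.range_eq_top.2 hbij.2)
    have hT : ∀ w : Y, S ((T.symm w : Y) : X) = w := fun w => T.apply_symm_apply w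
    set E : Set (Y × ℝ) := {q | fenchel f (q.1 : X) ≤ (q.2 : EReal)}
    have hmem : ∀ q : Y × ℝ, q ∈ E ↔
        ∀ x, f x ≠ ⊤ → ⟪x, (q.1 : X)⟫ - (f x).toReal ≤ q.2 :=
      fun q => fenchel_le_coe_iff hf.1 _ _
    have hclosed : IsClosed E := by
      have hEq : E = ⋂ x, ⋂ (_ : f x ≠ ⊤),
          {q : Y × ℝ | ⟪x, (q.1 : X)⟫ - (f x).toReal ≤ q.2} := by
        ext q; simp only [hmem, Set.mem_iInter, Set.mem_ofPred_eq]
      rw [hEq]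
      exact isClosed_iInter fun x => isClosed_iInter fun _ =>
        isClosed_le (by fun_prop) (by fun_prop)
    have hconvE : Convex ℝ E := by
      intro q hq q' hq' s t hs ht hst
      rw [hmem] at hq hq' ⊢
      intro x hx
      have h := mul_le_mul_of_nonneg_left (hq x hx) hs
      have h' := mul_le_mul_of_nonneg_left (hq' x hx) ht
      have hval : (f x).toReal = s * (f x).toReal + t * (f x).toReal := by
        rw [← add_mul, hst, one_mul]
      simp only [Prod.fst_add, Prod.smul_fst, Prod.snd_add, Prod.smul_snd, smul_eq_mul,
        Submodule.coe_add, Submodule.coe_smul, inner_add_right, real_inner_smul_right]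
      linarith
    have hne : E.Nonempty := by
      obtain ⟨y, hy⟩ := hres.2
      exact ⟨(y, (fenchel f (y : X)).toReal), EReal.le_coe_toReal hy⟩
    obtain ⟨x₀, hx₀⟩ := hf.2
    have hab : ∀ q ∈ E, ⟪Y.orthogonalProjectionOnto x₀, q.1⟫ - (f x₀).toReal ≤ q.2 := by
      intro q hq
      rw [Submodule.inner_orthogonalProjectionOnto_eq_of_mem_right]
      exact (hmem q).1 hq x₀ hx₀
    have hA : ∀ w : Y, (1 / 2) * ‖w‖ ^ 2 ≤ ⟪(-(T.symm : Y →L[ℝ] Y)) w, w⟫ := by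
      intro w
      have h := hSY (T.symm w)
      rw [hT] at h
      simp only [neg_apply, ContinuousLinearEquiv.coe_coe, inner_neg_left]
      linarith
    obtain ⟨p, hp, hvi⟩ := exists_epigraph_variational_inequality hclosed hconvE hne hab _ hA
    refine ⟨T.symm p.1, fun z => ?_⟩
    rw [hT]
    by_cases hz : fenchel f (z : X) = ⊤
    · simp [hz]
    have hreal := EReal.coe_toReal hz (hres.1 z)
    have h := hvi (z, (fenchel f (z : X)).toReal) (EReal.le_coe_toReal hz)
    simp only [neg_apply, ContinuousLinearEquiv.coe_coe, inner_neg_left,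
      sub_neg_eq_add] at h
    rw [real_inner_comm] at h
    calc fenchel f (p.1 : X) + ((⟪z - p.1, T.symm p.1⟫ : ℝ) : EReal)
        ≤ (p.2 : EReal) + ((⟪z - p.1, T.symm p.1⟫ : ℝ) : EReal) := by gcongr; exact hp
      _ ≤ ((fenchel f (z : X)).toReal : EReal) := by
        rw [← EReal.coe_add]; exact EReal.coe_le_coe_iff.2 h
      _ = fenchel f (z : X) := hreal
  · intro e e' he he'
    have hmono := inner_sub_nonneg_of_mem_subdiff hres he he'
    have h := hSY (e - e')
    rw [Submodule.coe_sub, map_sub, real_inner_comm] at h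
    have hzero : ‖S (e : X) - S (e' : X)‖ = 0 := by
      refine pow_eq_zero_iff two_ne_zero |>.1 (le_antisymm ?_ (sq_nonneg _))
      linarith
    exact hbij.1 (sub_eq_zero.1 (norm_eq_zero.1 hzero))
end
end

section
/- Let X be a real Hilbert space and Y a closed subspace of X. Let S be a bounded linear operator from X to Y whose restriction S|_Y : Y → Y is bijective, and suppose ⟪x, Sx⟫ + ½‖Sx‖² = 0 for all x ∈ X. Let f : X → (−∞, ∞] be proper, convex and lower semicontinuous with f*|_Y proper, and let e ∈ Y be a fixed point of ∂(f*|_Y) ∘ S|_Y (i.e. e ∈ ∂(f*|_Y)(Se)). Then for every x ∈ X, if Sx ∈ ∂f(x) then Sx = Se. -/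
open scoped RealInnerProductSpace

noncomputable section

/-- A subgradient of a proper function exists only at points of its domain. -/
theorem ne_top_of_mem_subdiff {H : Type*} [NormedAddCommGroup H] [InnerProductSpace ℝ H]
    {g : H → EReal} (hg : IsProperFn g) {y p : H} (hp : p ∈ subdiff g y) : g y ≠ ⊤ := by
  obtain ⟨z, hz⟩ := hg.2
  intro h
  have hle := hp z
  rw [h, EReal.top_add_coe] at hle
  exact hz (top_le_iff.mp hle)

/-- The Fenchel–Young inequality. -/
theorem inner_sub_le_fenchel {H : Type*} [NormedAddCommGroup H] [InnerProductSpace ℝ H]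
    (f : H → EReal) (x p : H) : ((⟪x, p⟫ : ℝ) : EReal) - f x ≤ fenchel f p :=
  le_iSup (fun z : H => ((⟪z, p⟫ : ℝ) : EReal) - f z) x

/-- The Fenchel–Young inequality is tight at a subgradient. -/
theorem fenchel_le_of_mem_subdiff {H : Type*} [NormedAddCommGroup H] [InnerProductSpace ℝ H]
    {f : H → EReal} {x p : H} {a : ℝ} (ha : f x = a) (hp : p ∈ subdiff f x) :
    fenchel f p ≤ ((⟪x, p⟫ - a : ℝ) : EReal) := by
  refine iSup_le fun z => ?_
  have hz := hp z
  rw [ha] at hz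
  generalize f z = c at hz ⊢
  induction c with
  | bot => exact absurd (le_bot_iff.mp hz) (by rw [← EReal.coe_add]; exact EReal.coe_ne_bot _)
  | top => simp
  | coe c =>
    rw [inner_sub_left] at hz
    norm_cast at hz ⊢
    linarith

theorem stmt_9 {X : Type*} [NormedAddCommGroup X] [InnerProductSpace ℝ X] [CompleteSpace X]
    (Y : Submodule ℝ X) (hY : IsClosed (Y : Set X))
    (S : X →L[ℝ] Y)
    (hbij : Function.Bijective (fun y : Y => S (y : X)))
    (hS : ∀ x : X, ⟪x, ((S x : Y) : X)⟫ + (1 / 2) * ‖S x‖ ^ 2 = 0)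
    (f : X → EReal) (hf : IsProperFn f) (hconv : IsConvexFn f)
    (hlsc : LowerSemicontinuous f)
    (hres : IsProperFn (fun y : Y => fenchel f (y : X)))
    (e : Y) (he : e ∈ subdiff (fun y : Y => fenchel f (y : X)) (S (e : X))) :
    ∀ x : X, ((S x : Y) : X) ∈ subdiff f x → S x = S (e : X) := by
  intro x hx
  have hfx := ne_top_of_mem_subdiff hf hx
  have hfe := ne_top_of_mem_subdiff hres he
  obtain ⟨a, ha⟩ : ∃ a : ℝ, f x = a := ⟨_, (EReal.coe_toReal hfx (hf.1 x)).symm⟩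
  obtain ⟨b, hb⟩ : ∃ b : ℝ, fenchel f (S (e : X) : X) = b :=
    ⟨_, (EReal.coe_toReal hfe (hres.1 _)).symm⟩
  have upper : b + ⟪S x - S (e : X), e⟫ ≤ ⟪x, ((S x : Y) : X)⟫ - a := by
    have h := (he (S x)).trans (fenchel_le_of_mem_subdiff ha hx)
    simp only [hb] at h
    exact_mod_cast h
  have lower : ⟪x, ((S (e : X) : Y) : X)⟫ - a ≤ b := by
    have h := inner_sub_le_fenchel f x (S (e : X) : X)
    rw [ha, hb] at h
    exact_mod_cast h
  have hSxe := hS (x - e)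
  rw [Submodule.coe_inner, Submodule.coe_sub, inner_sub_left,
    real_inner_comm (e : X) (S x : X), real_inner_comm (e : X) (S (e : X) : X)] at upper
  simp only [map_sub, Submodule.coe_sub, inner_sub_left, inner_sub_right] at hSxe
  have hnorm : ‖S x - S (e : X)‖ ^ 2 = 0 :=
    le_antisymm (by linarith) (sq_nonneg _)
  exact sub_eq_zero.mp (norm_eq_zero.mp (pow_eq_zero_iff two_ne_zero |>.mp hnorm))
end
end

section
/- Let X be a real Hilbert space and Y a closed subspace of X. Let S be a bounded linear operator from X to Y whose restriction S|_Y : Y → Y is bijective, and suppose ⟪x, Sx⟫ + ½‖Sx‖² = 0 for all x ∈ X. Let f : X → (−∞, ∞] be proper, convex and lower semicontinuous with f*|_Y proper, and let e ∈ Y be the fixed point of ∂(f*|_Y) ∘ S|_Y (i.e. e ∈ ∂(f*|_Y)(Se)). If x ∈ X attains the minimum of f over X (f(x) = min_X f), then the following are equivalent: (i) Sx ∈ ∂f(x); (ii) f*(Sx) + ½‖Sx‖² + f(x) = 0; (iii) Sx = Se. -/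
open scoped RealInnerProductSpace

noncomputable section

/-- The Fenchel–Young inequality at a point where `f` is finite. -/
theorem coe_inner_sub_le_fenchel {H : Type*} [NormedAddCommGroup H] [InnerProductSpace ℝ H]
    {f : H → EReal} {x : H} {a : ℝ} (hx : f x = a) (p : H) :
    ((⟪x, p⟫ - a : ℝ) : EReal) ≤ fenchel f p := by
  have h := le_iSup (fun z : H => ((⟪z, p⟫ : ℝ) : EReal) - f z) x
  rw [hx] at h
  exact_mod_cast h

/-- At a point where `f` is finite, subgradients are the points of equality in the
Fenchel–Young inequality. -/
theorem mem_subdiff_iff_fenchel_eq {H : Type*} [NormedAddCommGroup H] [InnerProductSpace ℝ H]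
    {f : H → EReal} (hf : ∀ z, f z ≠ ⊥) {x : H} {a : ℝ} (hx : f x = a) (p : H) :
    p ∈ subdiff f x ↔ fenchel f p = ((⟪x, p⟫ - a : ℝ) : EReal) := by
  have key : p ∈ subdiff f x ↔ fenchel f p ≤ ((⟪x, p⟫ - a : ℝ) : EReal) := by
    simp only [subdiff, Set.mem_ofPred_eq, fenchel, iSup_le_iff, hx]
    refine forall_congr' fun z => ?_
    have hz := hf z
    induction hfz : f z with
    | bot => exact absurd hfz hz
    | top => simp
    | coe b =>
      norm_cast
      rw [inner_sub_left]
      constructor <;> intro h <;> linarith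
  rw [key]
  exact ⟨fun h => le_antisymm h (coe_inner_sub_le_fenchel hx p), fun h => h.le⟩

/-- If `f` attains its minimum at `x`, its conjugate at `0` is at most `-f x`. -/
theorem fenchel_zero_le {H : Type*} [NormedAddCommGroup H] [InnerProductSpace ℝ H]
    {f : H → EReal} {x : H} (hmin : ∀ z, f x ≤ f z) : fenchel f 0 ≤ -f x := by
  refine iSup_le fun z => ?_
  simpa using hmin z

/-- A function that is proper is finite wherever it has a subgradient. -/
theorem exists_coe_eq_of_mem_subdiff {H : Type*} [NormedAddCommGroup H] [InnerProductSpace ℝ H]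
    {g : H → EReal} (hg : IsProperFn g) {y p : H} (hp : p ∈ subdiff g y) :
    ∃ c : ℝ, g y = c := by
  obtain ⟨z, hz⟩ := hg.2
  refine ⟨(g y).toReal, (EReal.coe_toReal (fun h => hz ?_) (hg.1 y)).symm⟩
  have hle := hp z
  rw [h, EReal.top_add_coe] at hle
  exact top_le_iff.mp hle

theorem stmt_11 {X : Type*} [NormedAddCommGroup X] [InnerProductSpace ℝ X] [CompleteSpace X]
    (Y : Submodule ℝ X) (hY : IsClosed (Y : Set X))
    (S : X →L[ℝ] Y)
    (hbij : Function.Bijective (fun y : Y => S (y : X)))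
    (hS : ∀ x : X, ⟪x, ((S x : Y) : X)⟫ + (1 / 2) * ‖S x‖ ^ 2 = 0)
    (f : X → EReal) (hf : IsProperFn f) (hconv : IsConvexFn f)
    (hlsc : LowerSemicontinuous f)
    (hres : IsProperFn (fun y : Y => fenchel f (y : X)))
    (e : Y) (he : e ∈ subdiff (fun y : Y => fenchel f (y : X)) (S (e : X)))
    (x : X) (hmin : ∀ z : X, f x ≤ f z) :
    (((S x : Y) : X) ∈ subdiff f x ↔
        fenchel f ((S x : Y) : X) + (((1 / 2) * ‖S x‖ ^ 2 : ℝ) : EReal) + f x = 0) ∧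
      (fenchel f ((S x : Y) : X) + (((1 / 2) * ‖S x‖ ^ 2 : ℝ) : EReal) + f x = 0 ↔
        S x = S (e : X)) := by
  obtain ⟨z₀, hz₀⟩ := hf.2
  obtain ⟨a, hx⟩ : ∃ a : ℝ, f x = a :=
    ⟨_, (EReal.coe_toReal (fun h => hz₀ (top_le_iff.mp (h ▸ hmin z₀))) (hf.1 x)).symm⟩
  obtain ⟨c, hc⟩ := exists_coe_eq_of_mem_subdiff hres he
  have hc' : fenchel f (S (e : X) : X) = c := hc
  have hsum : fenchel f (S x : X) + (((1 / 2) * ‖S x‖ ^ 2 : ℝ) : EReal) + f x = 0 ↔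
      fenchel f (S x : X) = ((⟪x, (S x : X)⟫ - a : ℝ) : EReal) := by
    rw [hx]
    have := hS x
    induction fenchel f (S x : X) with
    | bot =>
      simp only [EReal.bot_add]
      exact iff_of_false EReal.bot_ne_zero (EReal.bot_ne_coe _)
    | top =>
      simp only [EReal.top_add_coe]
      exact iff_of_false EReal.top_ne_zero (EReal.top_ne_coe _)
    | coe b =>
      norm_cast
      constructor <;> intro h <;> linarith
  refine ⟨(mem_subdiff_iff_fenchel_eq hf.1 hx _).trans hsum.symm,
    hsum.trans ⟨fun h => ?_, fun h => ?_⟩⟩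
  · have hle := he (S x)
    have hFY := coe_inner_sub_le_fenchel hx (S (e : X) : X)
    simp only [hc', h, Submodule.coe_inner, Submodule.coe_sub] at hle hFY
    norm_cast at hle hFY
    have hSd := hS (x - e)
    rw [map_sub] at hSd
    push_cast at hle hSd
    simp only [inner_sub_left, inner_sub_right] at hle hSd
    rw [real_inner_comm (S x : X) (e : X), real_inner_comm (S (e : X) : X) (e : X)] at hSd
    have : ‖S x - S (e : X)‖ ^ 2 ≤ 0 := by linarith
    exact sub_eq_zero.mp (norm_eq_zero.mp (pow_eq_zero_iff two_ne_zero |>.mp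
      (le_antisymm this (sq_nonneg _))))
  · have hFY := coe_inner_sub_le_fenchel hx (S x : X)
    have hle := (he 0).trans (fenchel_zero_le hmin)
    have hSx := hS x
    have hSe := hS e
    simp only [h, hc', hx, Submodule.coe_inner, zero_sub, inner_neg_left] at hle hFY hSx ⊢
    norm_cast at hle hFY ⊢
    rw [real_inner_comm] at hle
    linarith
end
end
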